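/- arXiv:2207.14544 — 2 statements merged into one kernel-verified Lean document; each statement's English description precedes it below -/
import Mathlib

section
/- For all integers m, n > 0 and every integer r with 0 ≤ r ≤ n−1, the number of paths P ∈ D(m,n,1) with val(P) = r satisfies n · #{P ∈ D(m,n,1) : val(P) = r} = C(n, r+1)·C(mn, r), as an identity of integers. -/
/-- A step of a lattice path: north `(0,1)`, east `(1,0)` or diagonal `(1,1)`. -/
inductive Step : Type
  | N : Step
  | E : Step
  | D : Step
  deriving DecidableEq

/-- The displacement vector of a step. -/
def stepVec : Step → ℤ × ℤ
  | .N => (0, 1)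
  | .E => (1, 0)
  | .D => (1, 1)

/-- The lattice point reached after the first `k` steps of the path `P` (starting at the
origin). -/
def pt (P : List Step) (k : ℕ) : ℤ × ℤ := ((P.take k).map stepVec).sum

/-- The path `P` starts with at least `t` north steps. -/
def StartsNorth (t : ℤ) (P : List Step) : Prop := List.replicate t.toNat Step.N <+: P

/-- The path `P` stays weakly above the line `x = m·y`. -/
def AboveLine (m : ℤ) (P : List Step) : Prop := ∀ k : ℕ, (pt P k).1 ≤ m * (pt P k).2

/-- An `(m,t)`-Schröder path of height `n`: a lattice path from `(0,0)` to `(mn,n)` using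
north, east and diagonal steps, starting with at least `t` north steps and never going
below the line `x = m·y`. -/
def IsSchroeder (m n t : ℤ) (P : List Step) : Prop :=
  StartsNorth t P ∧ pt P P.length = (m * n, n) ∧ AboveLine m P

/-- An `(m,t)`-Dyck path of height `n`: an `(m,t)`-Schröder path of height `n` with no
diagonal steps. -/
def IsDyck (m n t : ℤ) (P : List Step) : Prop :=
  IsSchroeder m n t P ∧ ∀ s ∈ P, s ≠ Step.D

/-- A Schröder path is small if none of its diagonal steps starts on the line `x = m·y`. -/
def IsSmall (m : ℤ) (P : List Step) : Prop :=
  ∀ j : ℕ, P[j]? = some Step.D → (pt P j).1 ≠ m * (pt P j).2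

/-- A Schröder path is positive if it touches the line `x = m·y` only at its two
endpoints. -/
def IsPositive (m : ℤ) (P : List Step) : Prop :=
  ∀ k : ℕ, 0 < k → k < P.length → (pt P k).1 ≠ m * (pt P k).2

/-- The set of indices `j` such that the `j`-th step of `P` is east and the `(j+1)`-st is
north; the corresponding valley point is `pt P (j+1)`. -/
def valleys (P : List Step) : Finset ℕ :=
  (Finset.range P.length).filter fun j => P[j]? = some Step.E ∧ P[j + 1]? = some Step.N

/-- The number of valleys of `P`. -/
def val (P : List Step) : ℕ := (valleys P).card

/-- The number of valleys of `P` whose `x`-coordinate is congruent to `i` modulo `m`. -/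
def ival (m i : ℤ) (P : List Step) : ℕ :=
  ((valleys P).filter fun j => (pt P (j + 1)).1 % m = i % m).card

/-- The set of returns of `P`: valleys of the form `(m·i, i)`. -/
def returns (m : ℤ) (P : List Step) : Finset ℕ :=
  (valleys P).filter fun j => (pt P (j + 1)).1 = m * (pt P (j + 1)).2

/-- The number of returns of `P`. -/
def ret (m : ℤ) (P : List Step) : ℕ := (returns m P).card

/-- The set of indices of diagonal steps of `P`. -/
def diags (P : List Step) : Finset ℕ :=
  (Finset.range P.length).filter fun j => P[j]? = some Step.D

/-- The number of diagonal steps of `P`. -/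
def dg (P : List Step) : ℕ := (diags P).card

/-- A Schröder path is `m`-divisible if every diagonal step ends at an `x`-coordinate
divisible by `m`. -/
def MDivisible (m : ℤ) (P : List Step) : Prop :=
  ∀ j ∈ diags P, m ∣ (pt P (j + 1)).1

/-- The number of cornered diagonal steps of `P`: diagonal steps connecting `(i·m − 1, i)`
to `(i·m, i + 1)` for some `i`. -/
def cd (m : ℤ) (P : List Step) : ℕ :=
  ((diags P).filter fun j => (pt P (j + 1)).1 = m * ((pt P (j + 1)).2 - 1)).card

/-- The generalized binomial coefficient `C(p,q) = p(p−1)⋯(p−q+1)/q!` for integers `p` and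
`q ≥ 0`, and `C(p,q) = 0` for `q < 0`. -/
def C (p q : ℤ) : ℤ :=
  if q < 0 then 0
  else if 0 ≤ p then (p.toNat.choose q.toNat : ℤ)
  else (-1) ^ q.toNat * ((q - p - 1).toNat.choose q.toNat : ℤ)

/-- The path with consecutive blocks of `a + 1` north and `b + 1` east steps, one for each
entry `(a, b)` of the list. -/
def blockWord : List (ℕ × ℕ) → List Step
  | [] => []
  | p :: l => List.replicate (p.1 + 1) Step.N ++ (List.replicate (p.2 + 1) Step.E ++ blockWord l)

/-- Splits a path into its initial run of east steps and the subsequent blocks. -/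
def blockDecode : List Step → ℕ × List (ℕ × ℕ)
  | [] => (0, [])
  | Step.N :: w =>
    match blockDecode w with
    | (0, []) => (0, [])
    | (0, p :: l) => (0, (p.1 + 1, p.2) :: l)
    | (k + 1, l) => (0, (0, k) :: l)
  | Step.E :: w => ((blockDecode w).1 + 1, (blockDecode w).2)
  | Step.D :: w => blockDecode w

theorem blockDecode_replicate_E_append (k : ℕ) (w : List Step) :
    blockDecode (List.replicate k Step.E ++ w) = ((blockDecode w).1 + k, (blockDecode w).2) := by
  induction k with
  | zero => rfl
  | succ k ih =>
    rw [List.replicate_succ, List.cons_append, blockDecode, ih]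
    rfl

theorem blockDecode_replicate_N_append (k : ℕ) (w : List Step) (p : ℕ × ℕ) (l : List (ℕ × ℕ))
    (h : blockDecode w = (0, p :: l)) :
    blockDecode (List.replicate k Step.N ++ w) = (0, (p.1 + k, p.2) :: l) := by
  induction k with
  | zero => simpa using h
  | succ k ih =>
    rw [List.replicate_succ, List.cons_append, blockDecode, ih]
    rfl

theorem blockDecode_blockWord (l : List (ℕ × ℕ)) : blockDecode (blockWord l) = (0, l) := by
  induction l with
  | nil => rfl
  | cons p l ih =>
    rw [blockWord, List.replicate_succ', List.append_assoc,
      blockDecode_replicate_N_append p.1 _ (0, p.2) l]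
    · simp
    · rw [List.singleton_append, blockDecode, blockDecode_replicate_E_append, ih]
      simp

theorem blockWord_injective : Function.Injective blockWord := fun l l' h => by
  have := congrArg blockDecode h
  simpa [blockDecode_blockWord] using this

theorem exists_append_E_eq_blockWord (w : List Step) (hw : ∀ s ∈ w, s ≠ Step.D) :
    ∃ k l, w ++ [Step.E] = List.replicate k Step.E ++ blockWord l := by
  induction w with
  | nil => exact ⟨1, [], rfl⟩
  | cons s w ih =>
    obtain ⟨k, l, h⟩ := ih fun t ht => hw t (List.mem_cons_of_mem _ ht)
    rw [List.cons_append, h]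
    cases s with
    | D => exact absurd rfl (hw _ List.mem_cons_self)
    | E => exact ⟨k + 1, l, rfl⟩
    | N =>
      cases k with
      | succ k => exact ⟨0, (0, k) :: l, rfl⟩
      | zero =>
        cases l with
        | nil => simp [blockWord] at h
        | cons p l => exact ⟨0, (p.1 + 1, p.2) :: l, rfl⟩

theorem exists_cons_N_append_E_eq_blockWord (w : List Step) (hw : ∀ s ∈ w, s ≠ Step.D) :
    ∃ l, (Step.N :: w) ++ [Step.E] = blockWord l := by
  obtain ⟨k, l, h⟩ := exists_append_E_eq_blockWord (Step.N :: w) (by simpa using hw)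
  cases k with
  | zero => exact ⟨l, h⟩
  | succ k => simp [List.replicate_succ] at h

theorem exists_blockWord_cons (p : ℕ × ℕ) (l : List (ℕ × ℕ)) :
    ∃ w, blockWord (p :: l) = (Step.N :: w) ++ [Step.E] := by
  induction l generalizing p with
  | nil =>
    refine ⟨List.replicate p.1 Step.N ++ List.replicate p.2 Step.E, ?_⟩
    rw [blockWord, List.replicate_succ, List.replicate_succ']
    simp [blockWord]
  | cons q l ih =>
    obtain ⟨w, hw⟩ := ih q
    refine ⟨List.replicate p.1 Step.N ++ (List.replicate (p.2 + 1) Step.E ++ (Step.N :: w)), ?_⟩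
    rw [blockWord, hw, List.replicate_succ]
    simp

theorem ne_D_of_mem_blockWord {l : List (ℕ × ℕ)} {s : Step} (hs : s ∈ blockWord l) :
    s ≠ Step.D := by
  induction l with
  | nil => simp [blockWord] at hs
  | cons p l ih =>
    simp only [blockWord, List.mem_append, List.mem_replicate] at hs
    rcases hs with ⟨-, rfl⟩ | ⟨-, rfl⟩ | hs
    · decide
    · decide
    · exact ih hs

theorem sum_stepVec_blockWord (l : List (ℕ × ℕ)) :
    ((blockWord l).map stepVec).sum =
      ((l.map fun p => (p.2 : ℤ) + 1).sum, (l.map fun p => (p.1 : ℤ) + 1).sum) := by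
  induction l with
  | nil => rfl
  | cons p l ih =>
    simp [blockWord, ih, stepVec]

theorem val_nil : val [] = 0 := rfl

theorem val_cons (s : Step) (w : List Step) :
    val (s :: w) = val w + if s = Step.E ∧ w[0]? = some Step.N then 1 else 0 := by
  simp only [val, valleys, Finset.card_filter, List.length_cons, Finset.sum_range_succ']
  simp

theorem val_append_E (w : List Step) : val (w ++ [Step.E]) = val w := by
  induction w with
  | nil => rfl
  | cons s w ih =>
    rw [List.cons_append, val_cons, val_cons, ih]
    cases w <;> simp

theorem val_replicate_N_append (k : ℕ) (w : List Step) :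
    val (List.replicate k Step.N ++ w) = val w := by
  induction k with
  | zero => rfl
  | succ k ih => rw [List.replicate_succ, List.cons_append, val_cons, ih]; simp

theorem val_replicate_E_append (k : ℕ) (w : List Step) :
    val (List.replicate (k + 1) Step.E ++ w) = val w + if w[0]? = some Step.N then 1 else 0 := by
  induction k with
  | zero => simp [val_cons]
  | succ k ih =>
    rw [List.replicate_succ, List.cons_append, val_cons, ih]
    simp [List.replicate_succ]

theorem val_blockWord_cons (p : ℕ × ℕ) (l : List (ℕ × ℕ)) :
    val (blockWord (p :: l)) = l.length := by
  induction l generalizing p with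
  | nil => rw [blockWord, val_replicate_N_append, val_replicate_E_append]; simp [blockWord, val_nil]
  | cons q l ih =>
    rw [blockWord, val_replicate_N_append, val_replicate_E_append, ih]
    simp [blockWord, List.replicate_succ]

/-- The amount `m·y - x` by which the endpoint of the path clears the line `x = m·y`. -/
def clearance (m : ℤ) (w : List Step) : ℤ :=
  m * (w.map stepVec).sum.2 - (w.map stepVec).sum.1

/-- All proper prefixes of the path, started at clearance `c`, have nonnegative clearance. -/
def StaysAbove (m c : ℤ) (w : List Step) : Prop :=
  ∀ k < w.length, 0 ≤ c + clearance m (w.take k)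

theorem staysAbove_cons (m c : ℤ) (s : Step) (w : List Step) :
    StaysAbove m c (s :: w) ↔
      0 ≤ c ∧ StaysAbove m (c + (m * (stepVec s).2 - (stepVec s).1)) w := by
  constructor
  · intro h
    refine ⟨by simpa [clearance] using h 0 (by simp), fun k hk => ?_⟩
    have := h (k + 1) (by simpa using hk)
    simp only [clearance, List.take_succ_cons, List.map_cons, List.sum_cons, Prod.fst_add,
      Prod.snd_add] at this ⊢
    linarith
  · rintro ⟨h0, h⟩ (_ | k) hk
    · simpa [clearance] using h0
    · have := h k (by simpa using hk)
      simp only [clearance, List.take_succ_cons, List.map_cons, List.sum_cons, Prod.fst_add,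
        Prod.snd_add] at this ⊢
      linarith

theorem staysAbove_replicate_N_append (m c : ℤ) (hm : 0 ≤ m) (hc : 0 ≤ c) (k : ℕ)
    (w : List Step) :
    StaysAbove m c (List.replicate k Step.N ++ w) ↔ StaysAbove m (c + m * k) w := by
  induction k generalizing c with
  | zero => simp
  | succ k ih =>
    rw [List.replicate_succ, List.cons_append, staysAbove_cons,
      ih _ (by simpa [stepVec] using by linarith)]
    have : c + (m * (stepVec Step.N).2 - (stepVec Step.N).1) + m * k = c + m * (k + 1 : ℕ) := by
      simp [stepVec]; ring
    rw [this]
    simp [hc]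

theorem staysAbove_replicate_E_append (m c : ℤ) (k : ℕ) (w : List Step) :
    StaysAbove m c (List.replicate (k + 1) Step.E ++ w) ↔
      (k : ℤ) ≤ c ∧ StaysAbove m (c - (k + 1)) w := by
  induction k generalizing c with
  | zero => simp [staysAbove_cons, stepVec, sub_eq_add_neg]
  | succ k ih =>
    rw [List.replicate_succ, List.cons_append, staysAbove_cons, ih]
    have : c + (m * (stepVec Step.E).2 - (stepVec Step.E).1) = c - 1 := by
      simp [stepVec]; ring
    rw [this, show c - 1 - ((k : ℤ) + 1) = c - (((k + 1 : ℕ) : ℤ) + 1) by push_cast; ring]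
    push_cast
    constructor
    · rintro ⟨h0, h1, h2⟩
      exact ⟨by linarith, h2⟩
    · rintro ⟨h1, h2⟩
      exact ⟨by linarith [Int.natCast_nonneg k], by linarith, h2⟩

/-- The change in clearance along the block encoded by `(a, b)`. -/
def blockWeight (m : ℤ) (p : ℕ × ℕ) : ℤ := m * (p.1 + 1) - (p.2 + 1)

theorem staysAbove_blockWord (m c : ℤ) (hm : 0 ≤ m) (l : List (ℕ × ℕ))
    (h : c + (l.map (blockWeight m)).sum = -1) :
    StaysAbove m c (blockWord l) ↔
      ∀ k < l.length, 0 ≤ c + ((l.take k).map (blockWeight m)).sum := by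
  induction l generalizing c with
  | nil => simp [StaysAbove, blockWord]
  | cons p l ih =>
    have key : (∀ k < (p :: l).length, 0 ≤ c + (((p :: l).take k).map (blockWeight m)).sum) ↔
        0 ≤ c ∧ ∀ k < l.length,
          0 ≤ c + blockWeight m p + ((l.take k).map (blockWeight m)).sum := by
      constructor
      · intro H
        refine ⟨by simpa using H 0 (by simp), fun k hk => ?_⟩
        simpa [add_assoc] using H (k + 1) (by simpa using hk)
      · rintro ⟨h0, H⟩ (_ | k) hk
        · simpa using h0
        · simpa [add_assoc] using H k (by simpa using hk)
    have h' : c + blockWeight m p + (l.map (blockWeight m)).sum = -1 := by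
      simpa [add_assoc] using h
    rw [key, ← ih _ h']
    by_cases hc : 0 ≤ c
    · rw [blockWord, staysAbove_replicate_N_append m c hm hc, staysAbove_replicate_E_append]
      have e : c + m * (p.1 + 1 : ℕ) - ((p.2 : ℤ) + 1) = c + blockWeight m p := by
        simp only [blockWeight]; push_cast; ring
      rw [e]
      simp only [hc, true_and, and_iff_right_iff_imp]
      intro H
      rcases l with _ | ⟨q, l⟩
      · simp at h'
        linarith
      · have := H 0 (by simp [blockWord])
        simp [clearance] at this
        linarith
    · simp only [hc, false_and, iff_false]
      intro H
      have := H 0 (by simp [blockWord])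
      simp [clearance] at this
      exact hc this

theorem isDyck_iff (m n : ℤ) (hm : 0 ≤ m) (p : ℕ × ℕ) (l : List (ℕ × ℕ)) :
    IsDyck m n 1 (blockWord (p :: l)).dropLast ↔
      (((p :: l).map fun p => (p.1 : ℤ) + 1).sum = n ∧
        ((p :: l).map fun p => (p.2 : ℤ) + 1).sum = m * n + 1) ∧
      ∀ k < (p :: l).length, 0 ≤ (((p :: l).take k).map (blockWeight m)).sum := by
  obtain ⟨w, hw⟩ := exists_blockWord_cons p l
  have hD : ∀ s ∈ Step.N :: w, s ≠ Step.D := fun s hs =>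
    ne_D_of_mem_blockWord (l := p :: l) (by rw [hw]; exact List.mem_append_left _ hs)
  have hS := sum_stepVec_blockWord (p :: l)
  generalize hL : p :: l = L at *
  have hsum : (L.map (blockWeight m)).sum =
      m * (L.map fun p => (p.1 : ℤ) + 1).sum - (L.map fun p => (p.2 : ℤ) + 1).sum := by
    clear hL hw hS
    induction L with
    | nil => simp
    | cons q L ih =>
      simp only [List.map_cons, List.sum_cons, ih, blockWeight]
      ring
  have hend : pt (Step.N :: w) (Step.N :: w).length = (m * n, n) ↔
      ((L.map fun p => (p.1 : ℤ) + 1).sum = n ∧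
        (L.map fun p => (p.2 : ℤ) + 1).sum = m * n + 1) := by
    rw [hw, List.map_append, List.sum_append, Prod.ext_iff] at hS
    obtain ⟨h1, h2⟩ := hS
    dsimp only at h1 h2
    rw [pt, List.take_length, Prod.ext_iff, ← h1, ← h2]
    simp [stepVec, and_comm]
  have habove : AboveLine m (Step.N :: w) ↔ StaysAbove m 0 (blockWord L) := by
    rw [hw]
    constructor
    · intro H k hk
      rw [List.take_append_of_le_length (by simpa using hk)]
      have := H k
      simp only [pt] at this
      simp only [clearance]
      linarith
    · intro H k
      have aux : ∀ k ≤ (Step.N :: w).length,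
          (pt (Step.N :: w) k).1 ≤ m * (pt (Step.N :: w) k).2 := by
        intro k hk
        have := H k (by simpa using hk)
        rw [List.take_append_of_le_length hk] at this
        simp only [clearance] at this
        simp only [pt]
        linarith
      rcases le_total k (Step.N :: w).length with hk | hk
      · exact aux k hk
      · have := aux _ le_rfl
        simpa only [pt, List.take_of_length_le hk, List.take_length] using this
  have hstart : StartsNorth 1 (Step.N :: w) := by simp [StartsNorth]
  have hdrop : (blockWord L).dropLast = Step.N :: w := by rw [hw, List.dropLast_concat]
  rw [hdrop, IsDyck, IsSchroeder, hend, habove]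
  simp only [hstart, true_and]
  constructor
  · rintro ⟨⟨h1, h2⟩, -⟩
    refine ⟨h1, ?_⟩
    simpa using (staysAbove_blockWord m 0 hm L (by rw [hsum, h1.1, h1.2]; ring)).1 h2
  · rintro ⟨h1, h2⟩
    refine ⟨⟨h1, ?_⟩, hD⟩
    exact (staysAbove_blockWord m 0 hm L (by rw [hsum, h1.1, h1.2]; ring)).2 (by simpa using h2)

theorem exists_cyclic_shift_of_sum_eq_neg_one (L : ℕ) (hL : 0 < L) (S : ℕ → ℤ)
    (hS : ∀ j, S (j + L) = S j - 1) :
    ∃ i < L, ∀ k < L, S i ≤ S (i + k) := by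
  have hne : (Finset.range L).Nonempty := ⟨0, by simpa using hL⟩
  obtain ⟨i₀, hi₀, hmin⟩ := Finset.exists_min_image (Finset.range L) S hne
  have hex : ∃ i, i < L ∧ ∀ j < L, S i ≤ S j :=
    ⟨i₀, by simpa using hi₀, fun j hj => hmin j (by simpa using hj)⟩
  classical
  obtain ⟨hi, hle⟩ := Nat.find_spec hex
  refine ⟨Nat.find hex, hi, fun k hk => ?_⟩
  rcases lt_or_ge (Nat.find hex + k) L with h | h
  · exact hle _ h
  · obtain ⟨j, hj⟩ := Nat.exists_eq_add_of_le' h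
    have hji : j < Nat.find hex := by omega
    have hlt := Nat.find_min hex hji
    rw [hj, hS]
    by_contra hcon
    refine hlt ⟨by omega, fun t ht => ?_⟩
    have := hle t ht
    omega

theorem cyclic_shift_unique (L : ℕ) (S : ℕ → ℤ) (hS : ∀ j, S (j + L) = S j - 1)
    {i i' : ℕ} (hi : i < L) (hi' : i' < L) (h : ∀ k < L, S i ≤ S (i + k))
    (h' : ∀ k < L, S i' ≤ S (i' + k)) : i = i' := by
  wlog hlt : i < i' generalizing i i'
  · rcases (not_lt.1 hlt).eq_or_lt with heq | hgt
    · exact heq.symm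
    · exact (this hi' hi h' h hgt).symm
  · have h1 := h (i' - i) (by omega)
    have h2 := h' (i + L - i') (by omega)
    rw [show i + (i' - i) = i' by omega] at h1
    rw [show i' + (i + L - i') = i + L by omega, hS] at h2
    omega

/-- **Cycle lemma**: a cyclic integer sequence with total `-1` has exactly one starting point
from which all proper partial sums are nonnegative. -/
theorem existsUnique_cyclic_shift (r : ℕ) (x : Fin (r + 1) → ℤ) (hx : ∑ i, x i = -1) :
    ∃! i : Fin (r + 1), ∀ k < r + 1,
      0 ≤ ∑ j ∈ Finset.range k, x (Fin.ofNat (r + 1) j + i) := by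
  set S : ℕ → ℤ := fun j => ∑ t ∈ Finset.range j, x (Fin.ofNat (r + 1) t) with hSdef
  have hS : ∀ j, S (j + (r + 1)) = S j - 1 := by
    intro j
    have h0 : S (r + 1) = -1 := by
      rw [hSdef, ← hx]
      simp [Finset.sum_range]
    rw [add_comm]
    simp only [hSdef]
    rw [Finset.sum_range_add _ (r + 1) j]
    have : ∀ t : ℕ, Fin.ofNat (r + 1) (r + 1 + t) = Fin.ofNat (r + 1) t := by
      intro t
      ext
      simp
    simp only [this]
    simp only [hSdef] at h0
    rw [h0]
    ring
  have hshift : ∀ (i : Fin (r + 1)) (k : ℕ),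
      ∑ j ∈ Finset.range k, x (Fin.ofNat (r + 1) j + i) = S (i + k) - S i := by
    intro i k
    simp only [hSdef, Finset.sum_range_add, add_sub_cancel_left]
    refine Finset.sum_congr rfl fun j _ => ?_
    congr 1
    ext
    simp [Fin.val_add, add_comm]
  simp only [hshift, sub_nonneg]
  obtain ⟨i, hi, h⟩ := exists_cyclic_shift_of_sum_eq_neg_one (r + 1) r.succ_pos S hS
  refine ⟨⟨i, hi⟩, h, fun i' h' => ?_⟩
  exact Fin.ext (cyclic_shift_unique (r + 1) S hS i'.2 hi h' h)

theorem card_piAntidiag_univ_fin (r N : ℕ) :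
    (Finset.piAntidiag (Finset.univ : Finset (Fin (r + 1))) N).card = (N + r).choose r := by
  rw [← Finset.map_sym_eq_piAntidiag, Finset.card_map, Finset.sym_univ, Finset.card_univ,
    Sym.card_sym_eq_choose, Fintype.card_fin, show r + 1 + N - 1 = N + r by omega,
    Nat.choose_symm_add]

/-- The pairs of sequences of length `r + 1` with sums `A` and `B` all of whose proper partial
block weights are nonnegative. -/
def goodBlocks (m : ℤ) (r A B : ℕ) : Finset ((Fin (r + 1) → ℕ) × (Fin (r + 1) → ℕ)) :=
  {q ∈ Finset.piAntidiag Finset.univ A ×ˢ Finset.piAntidiag Finset.univ B |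
    ∀ k < r + 1, 0 ≤ ∑ j ∈ Finset.range k,
      blockWeight m (q.1 (Fin.ofNat (r + 1) j), q.2 (Fin.ofNat (r + 1) j))}

theorem card_goodBlocks (m : ℤ) (r A B : ℕ) (h : m * (A + (r + 1)) - (B + (r + 1)) = -1) :
    (r + 1) * (goodBlocks m r A B).card = (A + r).choose r * (B + r).choose r := by
  rw [← card_piAntidiag_univ_fin, ← card_piAntidiag_univ_fin, ← Finset.card_product]
  set T := Finset.piAntidiag (Finset.univ : Finset (Fin (r + 1))) A ×ˢ
    Finset.piAntidiag (Finset.univ : Finset (Fin (r + 1))) B with hT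
  let good : Fin (r + 1) → (Fin (r + 1) → ℕ) × (Fin (r + 1) → ℕ) → Prop := fun i q =>
    ∀ k < r + 1, 0 ≤ ∑ j ∈ Finset.range k,
      blockWeight m (q.1 (Fin.ofNat (r + 1) j + i), q.2 (Fin.ofNat (r + 1) j + i))
  classical
  have hone : ∀ q ∈ T, (Finset.univ.filter fun i => good i q).card = 1 := by
    intro q hq
    simp only [hT, Finset.mem_product, Finset.mem_piAntidiag, Finset.mem_univ, implies_true,
      and_true] at hq
    have hsum : ∑ i, blockWeight m (q.1 i, q.2 i) = -1 := by
      simp only [blockWeight, Finset.sum_sub_distrib, ← Finset.mul_sum, Finset.sum_add_distrib,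
        ← Nat.cast_sum, hq.1, hq.2]
      simpa using h
    obtain ⟨i, hi, huniq⟩ := existsUnique_cyclic_shift r _ hsum
    rw [Finset.card_eq_one]
    refine ⟨i, Finset.ext fun j => ?_⟩
    simp only [Finset.mem_filter, Finset.mem_univ, true_and, Finset.mem_singleton]
    exact ⟨huniq j, fun hj => hj ▸ hi⟩
  have hrot : ∀ i, (T.filter fun q => good i q).card = (goodBlocks m r A B).card := by
    intro i
    have hs : ∀ (f : Fin (r + 1) → ℕ) (i : Fin (r + 1)), ∑ j, f (j + i) = ∑ j, f j :=
      fun f i => Equiv.sum_comp (Equiv.addRight i) f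
    refine Finset.card_bij' (fun q _ => (fun j => q.1 (j + i), fun j => q.2 (j + i)))
      (fun q _ => (fun j => q.1 (j + -i), fun j => q.2 (j + -i))) ?_ ?_ ?_ ?_
    · intro q hq
      simpa [hT, goodBlocks, good, hs] using hq
    · intro q hq
      simpa [hT, goodBlocks, good, hs] using hq
    · intro q _
      simp
    · intro q _
      simp
  calc (r + 1) * (goodBlocks m r A B).card
      = ∑ i : Fin (r + 1), (T.filter fun q => good i q).card := by simp [hrot]
    _ = ∑ q ∈ T, (Finset.univ.filter fun i => good i q).card := by
        simp only [Finset.card_filter]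
        exact Finset.sum_comm
    _ = T.card := by rw [Finset.sum_congr rfl hone, Finset.card_eq_sum_ones]

theorem sum_map_take_ofFn {α : Type*} (r : ℕ) (F : Fin (r + 1) → α) (w : α → ℤ) (k : ℕ)
    (hk : k ≤ r + 1) :
    (((List.ofFn F).take k).map w).sum = ∑ j ∈ Finset.range k, w (F (Fin.ofNat (r + 1) j)) := by
  induction k with
  | zero => simp
  | succ k ih =>
    rw [Finset.sum_range_succ, ← ih (by omega), List.map_take, List.map_take,
      List.sum_take_succ _ _ (by simpa using hk)]
    congr 1
    simp only [List.getElem_map, List.getElem_ofFn]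
    congr 2
    ext
    simp [Nat.mod_eq_of_lt (show k < r + 1 by omega)]

/-- The path of a pair of sequences of block lengths, with its last east step removed. -/
def blockPath (r : ℕ) (q : (Fin (r + 1) → ℕ) × (Fin (r + 1) → ℕ)) : List Step :=
  (blockWord (List.ofFn fun i => (q.1 i, q.2 i))).dropLast

theorem blockPath_append_E (r : ℕ) (q : (Fin (r + 1) → ℕ) × (Fin (r + 1) → ℕ)) :
    blockPath r q ++ [Step.E] = blockWord (List.ofFn fun i => (q.1 i, q.2 i)) := by
  rw [blockPath, List.ofFn_succ]
  obtain ⟨w, hw⟩ := exists_blockWord_cons (q.1 0, q.2 0)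
    (List.ofFn fun i : Fin r => (q.1 i.succ, q.2 i.succ))
  rw [hw, List.dropLast_concat]

theorem blockPath_injective (r : ℕ) : Function.Injective (blockPath r) := by
  intro q q' h
  have h' := congrArg (· ++ [Step.E]) h
  simp only [blockPath_append_E] at h'
  have := List.ofFn_injective (blockWord_injective h')
  simp only [funext_iff, Prod.mk.injEq] at this
  exact Prod.ext (funext fun i => (this i).1) (funext fun i => (this i).2)

theorem val_blockPath (r : ℕ) (q : (Fin (r + 1) → ℕ) × (Fin (r + 1) → ℕ)) :
    val (blockPath r q) = r := by
  rw [← val_append_E, blockPath_append_E, List.ofFn_succ, val_blockWord_cons, List.length_ofFn]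

theorem isDyck_blockPath_iff (m n : ℤ) (r A B : ℕ) (hm : 0 ≤ m) (hA : (A : ℤ) + (r + 1) = n)
    (hB : (B : ℤ) + (r + 1) = m * n + 1) (q : (Fin (r + 1) → ℕ) × (Fin (r + 1) → ℕ)) :
    IsDyck m n 1 (blockPath r q) ↔ q ∈ goodBlocks m r A B := by
  have hsum : ∀ f : Fin (r + 1) → ℕ, ∑ i, ((f i : ℤ) + 1) = (∑ i, f i : ℕ) + (r + 1) := by
    intro f
    simp [Finset.sum_add_distrib]
  rw [blockPath, List.ofFn_succ, isDyck_iff m n hm, ← List.ofFn_succ (f := fun i => (q.1 i, q.2 i))]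
  simp only [List.map_ofFn, List.sum_ofFn, Function.comp_def, List.length_ofFn, hsum]
  rw [← hB, ← hA]
  simp only [goodBlocks, Finset.mem_filter, Finset.mem_product, Finset.mem_piAntidiag,
    Finset.mem_univ, implies_true, and_true, add_left_inj, Nat.cast_inj]
  refine and_congr_right fun _ => forall₂_congr fun k hk => ?_
  rw [sum_map_take_ofFn r _ _ k hk.le]

theorem exists_eq_blockPath (m n : ℤ) (P : List Step) (hP : IsDyck m n 1 P) :
    ∃ q, P = blockPath (val P) q := by
  obtain ⟨⟨⟨w, rfl⟩, -⟩, hD⟩ := hP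
  simp only [Int.toNat_one, List.replicate_one, List.singleton_append] at hD ⊢
  obtain ⟨l, hl⟩ := exists_cons_N_append_E_eq_blockWord w fun s hs =>
    hD s (List.mem_cons_of_mem _ hs)
  have hval : l.length = val (Step.N :: w) + 1 := by
    rw [← val_append_E, hl]
    cases l with
    | nil => simp [blockWord] at hl
    | cons p l => rw [val_blockWord_cons, List.length_cons]
  generalize val (Step.N :: w) = r at hval
  refine ⟨(fun i => (l[i]'(by omega)).1, fun i => (l[i]'(by omega)).2), ?_⟩
  rw [← List.append_left_inj [Step.E], blockPath_append_E, hl]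
  congr 1
  refine List.ext_getElem (by simp [hval]) fun i _ _ => by simp [-List.ofFn_succ]

theorem setOf_isDyck_val_eq (m n : ℤ) (r A B : ℕ) (hm : 0 ≤ m) (hA : (A : ℤ) + (r + 1) = n)
    (hB : (B : ℤ) + (r + 1) = m * n + 1) :
    {P : List Step | IsDyck m n 1 P ∧ (val P : ℤ) = r} =
      blockPath r '' (goodBlocks m r A B : Set _) := by
  ext P
  simp only [Set.mem_ofPred_eq, Set.mem_image, Finset.mem_coe, Nat.cast_inj]
  constructor
  · rintro ⟨hP, rfl⟩
    obtain ⟨q, hq⟩ := exists_eq_blockPath m n P hP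
    refine ⟨q, ?_, hq.symm⟩
    rw [← isDyck_blockPath_iff m n _ A B hm hA hB, ← hq]
    exact hP
  · rintro ⟨q, hq, rfl⟩
    exact ⟨(isDyck_blockPath_iff m n r A B hm hA hB q).2 hq, val_blockPath r q⟩

theorem C_natCast (p q : ℕ) : C p q = p.choose q := by
  simp [C]

/-- the number of `(m,1)`-Dyck paths of height `n` with `r` valleys. -/
theorem statement12 (m n r : ℤ) (hm : 0 < m) (hn : 0 < n) (hr0 : 0 ≤ r) (hr : r ≤ n - 1) :
    n * (({P : List Step | IsDyck m n 1 P ∧ (val P : ℤ) = r}.ncard : ℤ))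
      = C n (r + 1) * C (m * n) r := by
  lift r to ℕ using hr0
  obtain ⟨A, hA⟩ : ∃ A : ℕ, (A : ℤ) + (r + 1) = n := ⟨(n - (r + 1)).toNat, by omega⟩
  obtain ⟨B, hB⟩ : ∃ B : ℕ, (B : ℤ) + (r + 1) = m * n + 1 :=
    ⟨(m * n - r).toNat, by
      have : n ≤ m * n := le_mul_of_one_le_left hn.le hm
      omega⟩
  rw [setOf_isDyck_val_eq m n r A B hm.le hA hB,
    Set.ncard_image_of_injective _ (blockPath_injective r), Set.ncard_coe_finset]
  have hcard := card_goodBlocks m r A B (by rw [hA, hB]; ring)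
  have hn' : n = ((A + r + 1 : ℕ) : ℤ) := by push_cast; linarith
  have hmn : m * n = ((B + r : ℕ) : ℤ) := by push_cast; linarith
  rw [hmn, hn', show (r : ℤ) + 1 = ((r + 1 : ℕ) : ℤ) by push_cast; rfl, C_natCast, C_natCast]
  norm_cast
  have hchoose := Nat.add_one_mul_choose_eq (A + r) r
  refine Nat.eq_of_mul_eq_mul_left r.succ_pos ?_
  calc (r + 1) * ((A + r + 1) * (goodBlocks m r A B).card)
      = (A + r + 1) * ((r + 1) * (goodBlocks m r A B).card) := by ring
    _ = (A + r + 1) * (A + r).choose r * (B + r).choose r := by rw [hcard]; ring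
    _ = (r + 1) * ((A + r + 1).choose (r + 1) * (B + r).choose r) := by rw [hchoose]; ring
end

section
/- For all integers m, n > 0, every integer i with 1 ≤ i ≤ m, and every integer r with 0 ≤ r ≤ n−1, the number of paths P ∈ D(m,n,1) with val(P,i) = r satisfies n · #{P ∈ D(m,n,1) : val(P,i) = r} = C(n, r)·C(mn, n−r−1), as an identity of integers (in particular this count is independent of i). -/
/-- The binomial coefficient as a rational number, extended by zero to negative lower index. -/
def intChoose (A : ℕ) (s : ℤ) : ℚ := if s < 0 then 0 else (A.choose s.toNat : ℚ)

theorem intChoose_of_neg (A : ℕ) {s : ℤ} (hs : s < 0) : intChoose A s = 0 := if_pos hs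

theorem intChoose_natCast (A s : ℕ) : intChoose A s = A.choose s := by
  simp [intChoose]

theorem intChoose_zero_right (A : ℕ) : intChoose A 0 = 1 := by
  simp [intChoose]

theorem intChoose_succ (A : ℕ) (s : ℤ) :
    intChoose (A + 1) s = intChoose A s + intChoose A (s - 1) := by
  rcases lt_trichotomy s 0 with hs | rfl | hs
  · rw [intChoose_of_neg _ hs, intChoose_of_neg _ hs, intChoose_of_neg _ (by lia), add_zero]
  · rw [intChoose_zero_right, intChoose_zero_right, intChoose_of_neg _ (by lia), add_zero]
  · obtain ⟨k, rfl⟩ : ∃ k : ℕ, s = (k + 1 : ℕ) := ⟨(s - 1).toNat, by lia⟩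
    rw [show ((k + 1 : ℕ) : ℤ) - 1 = (k : ℕ) by lia, intChoose_natCast, intChoose_natCast,
      intChoose_natCast, Nat.choose_succ_succ, add_comm]
    push_cast
    rfl

theorem mul_intChoose_succ (A : ℕ) (s : ℤ) :
    s * intChoose (A + 1) s = (A + 1) * intChoose A (s - 1) := by
  rcases lt_trichotomy s 0 with hs | rfl | hs
  · rw [intChoose_of_neg _ hs, intChoose_of_neg _ (by lia), mul_zero, mul_zero]
  · rw [intChoose_of_neg _ (show (0 : ℤ) - 1 < 0 by lia)]
    simp
  · obtain ⟨k, rfl⟩ : ∃ k : ℕ, s = (k + 1 : ℕ) := ⟨(s - 1).toNat, by lia⟩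
    rw [show ((k + 1 : ℕ) : ℤ) - 1 = (k : ℕ) by lia, intChoose_natCast, intChoose_natCast]
    have := Nat.add_one_mul_choose_eq A k
    have h : ((A + 1 : ℕ) : ℚ) * A.choose k = (A + 1).choose (k + 1) * ((k + 1 : ℕ) : ℚ) := by
      exact_mod_cast this
    push_cast at h ⊢
    linarith

/-- The coefficient of `z ^ n * t ^ r` in `(1 + F) ^ a * (1 + t * F) ^ b`, where `F` is the power
series solution of `F = z * (1 + F) ^ m * (1 + t * F)`, in the closed form given by Lagrange
inversion. -/
def fussCoeff (m a b : ℕ) : ℕ → ℤ → ℚ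
  | 0, r => if r = 0 then 1 else 0
  | n + 1, r =>
    (a * intChoose (n + 1 + b) r * intChoose (m * (n + 1) + a - 1) (n - r) +
      b * intChoose (n + b) (r - 1) * intChoose (m * (n + 1) + a) (n + 1 - r)) / (n + 1)

theorem fussCoeff_zero_zero_succ (m n : ℕ) (r : ℤ) : fussCoeff m 0 0 (n + 1) r = 0 := by
  simp [fussCoeff]

theorem fussCoeff_succ_left {m : ℕ} (hm : 0 < m) (a b n : ℕ) (r : ℤ) :
    fussCoeff m (a + 1) b (n + 1) r =
      fussCoeff m a b (n + 1) r + fussCoeff m (a + m) (b + 1) n r := by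
  obtain ⟨A, hA⟩ : ∃ A, m * (n + 1) + a = A + 1 :=
    Nat.exists_eq_succ_of_ne_zero (by positivity)
  have hAq : (m : ℚ) * (n + 1) + a = A + 1 := by exact_mod_cast hA
  have hA' : m * (n + 1) + (a + 1) = A + 1 + 1 := by lia
  rcases n with _ | n
  · simp only [fussCoeff]
    rw [hA', hA]
    simp only [Nat.add_sub_cancel]
    rcases lt_trichotomy r 0 with hr | rfl | hr
    · rw [intChoose_of_neg _ hr, intChoose_of_neg _ (show r - 1 < 0 by lia), if_neg (by lia)]
      simp
    · rw [intChoose_of_neg _ (show (0 : ℤ) - 1 < 0 by lia)]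
      simp [intChoose_zero_right]
    · rw [if_neg (by lia), intChoose_of_neg (s := ((0 : ℕ) : ℤ) - r) _ (by push_cast; lia),
        intChoose_of_neg (s := ((0 : ℕ) : ℤ) - r) _ (by push_cast; lia), intChoose_succ (A + 1),
        intChoose_of_neg (s := ((0 : ℕ) : ℤ) + 1 - r - 1) _ (by push_cast; lia)]
      simp
  · simp only [fussCoeff]
    have hA'' : m * (n + 1) + (a + m) = A + 1 := by
      rw [← hA]; ring
    rw [hA', hA, hA'']
    simp only [Nat.add_sub_cancel]
    have e1 := intChoose_succ (A + 1) ((n : ℤ) + 1 + 1 - r)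
    have e2 := mul_intChoose_succ A ((n : ℤ) + 1 - r)
    have e3 := mul_intChoose_succ (n + 1 + b) r
    have e4 := intChoose_succ A ((n : ℤ) + 1 - r)
    rw [show (n : ℤ) + 1 + 1 - r - 1 = n + 1 - r by ring] at e1
    rw [show (n : ℤ) + 1 - r - 1 = n - r by ring] at e2 e4
    rw [show n + 1 + (b + 1) = n + 1 + b + 1 by ring, show n + (b + 1) = n + 1 + b by ring,
      show n + 1 + 1 + b = n + 1 + b + 1 by ring]
    push_cast at e1 e2 e3 e4 hAq ⊢
    rw [e1]
    have hn : (n : ℚ) + 1 ≠ 0 := by positivity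
    have hn2 : (n : ℚ) + 1 + 1 ≠ 0 := by positivity
    field_simp
    generalize intChoose (n + 1 + b + 1) r = X at *
    generalize intChoose (n + 1 + b) (r - 1) = X' at *
    generalize intChoose (A + 1) ((n : ℤ) + 1 - r) = Y at *
    generalize intChoose A ((n : ℤ) - r) = Y' at *
    generalize intChoose A ((n : ℤ) + 1 - r) = Y'' at *
    generalize intChoose (A + 1) ((n : ℤ) + 1 + 1 - r) = Z at *
    obtain rfl : Y'' = Y - Y' := by linarith
    linear_combination X * e2 + Y * e3 - X * Y' * hAq

theorem fussCoeff_succ_right {m : ℕ} (hm : 0 < m) (a b n : ℕ) (r : ℤ) :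
    fussCoeff m a (b + 1) (n + 1) r =
      fussCoeff m a b (n + 1) r + fussCoeff m (a + m) (b + 1) n (r - 1) := by
  obtain ⟨A, hA⟩ : ∃ A, m * (n + 1) + a = A + 1 :=
    Nat.exists_eq_succ_of_ne_zero (by positivity)
  have hAq : (m : ℚ) * (n + 1) + a = A + 1 := by exact_mod_cast hA
  have e5 : (b : ℚ) * intChoose (n + b + 1) (r - 1) =
      b * (intChoose (n + b) (r - 1) + intChoose (n + b) (r - 1 - 1)) := by
    rw [intChoose_succ]
  have e6 := intChoose_succ (n + 1 + b) r
  rcases n with _ | n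
  · simp only [fussCoeff]
    rw [hA]
    simp only [Nat.add_sub_cancel]
    rw [← add_assoc, e6]
    rcases lt_trichotomy r 1 with hr | rfl | hr
    · rw [if_neg (by lia), intChoose_of_neg (s := r - 1) _ (by lia),
        intChoose_of_neg (s := r - 1) _ (by lia), intChoose_of_neg (s := r - 1) _ (by lia)]
      simp
    · rw [intChoose_of_neg (s := ((0 : ℕ) : ℤ) - 1) _ (by simp)]
      simp [intChoose_zero_right]
    · rw [if_neg (by lia), intChoose_of_neg (s := ((0 : ℕ) : ℤ) - r) _ (by push_cast; lia),
        intChoose_of_neg (s := ((0 : ℕ) : ℤ) + 1 - r) _ (by push_cast; lia)]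
      simp
  · simp only [fussCoeff]
    have hA'' : m * (n + 1) + (a + m) = A + 1 := by
      rw [← hA]; ring
    rw [hA, hA'']
    simp only [Nat.add_sub_cancel]
    have e2 := mul_intChoose_succ A ((n : ℤ) + 1 + 1 - r)
    have e3 := mul_intChoose_succ (n + 1 + b) (r - 1)
    rw [show (n : ℤ) + 1 + 1 - r - 1 = n + 1 - r by ring] at e2
    rw [show n + 1 + 1 + (b + 1) = n + 1 + 1 + b + 1 by ring, e6,
      show n + 1 + (b + 1) = n + 1 + b + 1 by ring, show n + (b + 1) = n + 1 + b by ring,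
      show n + 1 + 1 + b = n + 1 + b + 1 by ring,
      show (n : ℤ) - (r - 1) = n + 1 - r by ring,
      show (n : ℤ) + 1 - (r - 1) = n + 1 + 1 - r by ring]
    push_cast at e2 e3 hAq e5 ⊢
    have hn : (n : ℚ) + 1 ≠ 0 := by positivity
    have hn2 : (n : ℚ) + 1 + 1 ≠ 0 := by positivity
    field_simp
    generalize intChoose (n + 1 + b + 1) (r - 1) = X at *
    generalize intChoose (n + 1 + b + 1) r = V at *
    generalize intChoose (n + 1 + b) (r - 1 - 1) = X' at *
    generalize intChoose (n + 1 + b) (r - 1) = X'' at *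
    generalize intChoose (A + 1) ((n : ℤ) + 1 + 1 - r) = Y at *
    generalize intChoose A ((n : ℤ) + 1 - r) = Y' at *
    linear_combination X * e2 + Y * e3 - X * Y' * hAq + (n + 1) * Y * e5

theorem succ_mul_fussCoeff {m : ℕ} (hm : 0 < m) (n : ℕ) (r : ℤ) :
    (n + 1) * fussCoeff m m 1 n r =
      intChoose (n + 1) r * intChoose (m * (n + 1)) (n - r) := by
  have h := fussCoeff_succ_left hm 0 0 n r
  rw [fussCoeff_zero_zero_succ, zero_add, zero_add, zero_add] at h
  rw [← h]
  have hn : (n : ℚ) + 1 ≠ 0 := by positivity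
  simp only [fussCoeff]
  field_simp
  simp

/-- A path with `n` north steps, no diagonal steps, from excess `k` to excess `0` which never has
negative excess, where the excess of a point `(x, y)` is `m * y - x`. -/
def IsDyckSuffix (m : ℕ) : ℕ → ℕ → List Step → Prop
  | 0, 0, [] => True
  | n + 1, k, .N :: P => IsDyckSuffix m n (k + m) P
  | n, k + 1, .E :: P => IsDyckSuffix m n k P
  | _, _, _ => False

/-- The number of valleys with `x`-coordinate congruent to `i` modulo `m` of a path starting at
`x`-coordinate `x`; the starting point counts as preceded by an east step if `l` is true. -/
def valleyCount (m : ℕ) (i : ℤ) : Bool → ℤ → List Step → ℕ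
  | _, _, [] => 0
  | l, x, .N :: P => (if l ∧ x % m = i % m then 1 else 0) + valleyCount m i false x P
  | _, x, .E :: P => valleyCount m i true (x + 1) P
  | _, x, .D :: P => valleyCount m i false (x + 1) P

/-- The number of `j < k` such that `x + j` is congruent to `i` modulo `m`. -/
def residueCount (m : ℕ) (i x : ℤ) : ℕ → ℕ
  | 0 => 0
  | k + 1 => (if x % m = i % m then 1 else 0) + residueCount m i (x + 1) k

/-- The number of `j < k` such that `x + j` is not congruent to `i` modulo `m`. -/
def nonresidueCount (m : ℕ) (i x : ℤ) : ℕ → ℕ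
  | 0 => 0
  | k + 1 => (if x % m = i % m then 0 else 1) + nonresidueCount m i (x + 1) k

theorem residueCount_eq_sum (m : ℕ) (i x : ℤ) (k : ℕ) :
    residueCount m i x k = ∑ j ∈ Finset.range k, if (x + j) % m = i % m then 1 else 0 := by
  induction k generalizing x with
  | zero => rfl
  | succ k ih =>
    rw [residueCount, ih, Finset.sum_range_succ', add_comm]
    simp [add_assoc, add_comm (1 : ℤ)]

theorem residueCount_add_nonresidueCount (m : ℕ) (i x : ℤ) (k : ℕ) :
    residueCount m i x k + nonresidueCount m i x k = k := by
  induction k generalizing x with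
  | zero => rfl
  | succ k ih =>
    have := ih (x + 1)
    rw [residueCount, nonresidueCount]
    split_ifs <;> lia

theorem residueCount_add_self {m : ℕ} (hm : 0 < m) (i x : ℤ) (k : ℕ) :
    residueCount m i x (k + m) = residueCount m i x k + 1 := by
  have hm' : (0 : ℤ) < m := by exact_mod_cast hm
  rw [residueCount_eq_sum, residueCount_eq_sum, Finset.sum_range_add]
  congr 1
  rw [← Finset.card_filter, Finset.card_eq_one]
  refine ⟨((i - x - k) % m).toNat, ?_⟩
  have h0 := Int.emod_nonneg (i - x - k) hm'.ne'
  have h1 := Int.emod_lt_of_pos (i - x - k) hm'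
  ext j
  simp only [Finset.mem_filter, Finset.mem_range, Finset.mem_singleton]
  have key : (x + ((k + j : ℕ) : ℤ)) % m = i % m ↔ (j : ℤ) % m = (i - x - k) % m := by
    rw [Int.emod_eq_emod_iff_emod_sub_eq_zero, Int.emod_eq_emod_iff_emod_sub_eq_zero (m := (j : ℤ))]
    push_cast
    ring_nf
  rw [key]
  constructor
  · rintro ⟨hj, h⟩
    rw [Int.emod_eq_of_lt (by lia) (by lia)] at h
    lia
  · rintro rfl
    refine ⟨by lia, ?_⟩
    rw [Int.toNat_of_nonneg h0, Int.emod_emod_of_dvd _ dvd_rfl]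

theorem nonresidueCount_add_self {m : ℕ} (hm : 0 < m) (i x : ℤ) (k : ℕ) :
    nonresidueCount m i x (k + m) + 1 = nonresidueCount m i x k + m := by
  have h1 := residueCount_add_nonresidueCount m i x k
  have h2 := residueCount_add_nonresidueCount m i x (k + m)
  have h3 := residueCount_add_self hm i x k
  lia

/-- The paths counted by `n`, `k`, `r` which may follow a point with `x`-coordinate `x`, where `l`
tells whether this point is preceded by an east step. -/
def suffixSet (m : ℕ) (i : ℤ) (n k : ℕ) (l : Bool) (x r : ℤ) : Set (List Step) :=
  {P | IsDyckSuffix m n k P ∧ (valleyCount m i l x P : ℤ) = r}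

theorem suffixSet_zero_zero (m : ℕ) (i : ℤ) (l : Bool) (x r : ℤ) :
    suffixSet m i 0 0 l x r = if r = 0 then {[]} else ∅ := by
  ext P
  rcases P with _ | ⟨_ | _ | _, P⟩ <;> split_ifs with h <;>
    simp [suffixSet, IsDyckSuffix, valleyCount, h, eq_comm]

theorem suffixSet_zero_succ (m : ℕ) (i : ℤ) (k : ℕ) (l : Bool) (x r : ℤ) :
    suffixSet m i 0 (k + 1) l x r = List.cons .E '' suffixSet m i 0 k true (x + 1) r := by
  ext P
  rcases P with _ | ⟨_ | _ | _, P⟩ <;> simp [suffixSet, IsDyckSuffix, valleyCount]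

theorem suffixSet_succ_zero (m : ℕ) (i : ℤ) (n : ℕ) (l : Bool) (x r : ℤ) :
    suffixSet m i (n + 1) 0 l x r = List.cons .N ''
      suffixSet m i n m false x (r - if l ∧ x % m = i % m then 1 else 0) := by
  ext P
  rcases P with _ | ⟨_ | _ | _, P⟩ <;>
    simp [suffixSet, IsDyckSuffix, valleyCount, eq_sub_iff_add_eq']

theorem suffixSet_succ_succ (m : ℕ) (i : ℤ) (n k : ℕ) (l : Bool) (x r : ℤ) :
    suffixSet m i (n + 1) (k + 1) l x r =
      List.cons .E '' suffixSet m i (n + 1) k true (x + 1) r ∪ List.cons .N ''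
      suffixSet m i n (k + 1 + m) false x (r - if l ∧ x % m = i % m then 1 else 0) := by
  ext P
  rcases P with _ | ⟨_ | _ | _, P⟩ <;>
    simp [suffixSet, IsDyckSuffix, valleyCount, eq_sub_iff_add_eq']

theorem finite_suffixSet (m : ℕ) (i : ℤ) (n k : ℕ) (l : Bool) (x r : ℤ) :
    (suffixSet m i n k l x r).Finite := by
  induction n generalizing k l x r with
  | zero =>
    induction k generalizing l x with
    | zero =>
      rw [suffixSet_zero_zero]
      split_ifs
      exacts [Set.finite_singleton _, Set.finite_empty]
    | succ k ih =>
      rw [suffixSet_zero_succ]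
      exact (ih _ _).image _
  | succ n ihn =>
    induction k generalizing l x with
    | zero =>
      rw [suffixSet_succ_zero]
      exact (ihn _ _ _ _).image _
    | succ k ih =>
      rw [suffixSet_succ_succ]
      exact ((ih _ _).image _).union ((ihn _ _ _ _).image _)

theorem ncard_suffixSet_succ_succ (m : ℕ) (i : ℤ) (n k : ℕ) (l : Bool) (x r : ℤ) :
    (suffixSet m i (n + 1) (k + 1) l x r).ncard =
      (suffixSet m i (n + 1) k true (x + 1) r).ncard +
      (suffixSet m i n (k + 1 + m) false x (r - if l ∧ x % m = i % m then 1 else 0)).ncard := by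
  rw [suffixSet_succ_succ, Set.ncard_union_eq _ ((finite_suffixSet ..).image _)
    ((finite_suffixSet ..).image _), Set.ncard_image_of_injective _ List.cons_injective,
    Set.ncard_image_of_injective _ List.cons_injective]
  rw [Set.disjoint_left]
  rintro _ ⟨P, _, rfl⟩ ⟨Q, _, h⟩
  simp at h

/-- The number of unmarked factors in the product formula for the generating function of
`suffixSet`. -/
def unmarkedExp (m : ℕ) (i : ℤ) (k : ℕ) (l : Bool) (x : ℤ) : ℕ :=
  (if l ∧ x % m = i % m then 0 else 1) + nonresidueCount m i (x + 1) k

/-- The number of factors marking an `i`-valley in the product formula for the generating function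
of `suffixSet`. -/
def markedExp (m : ℕ) (i : ℤ) (k : ℕ) (l : Bool) (x : ℤ) : ℕ :=
  (if l ∧ x % m = i % m then 1 else 0) + residueCount m i (x + 1) k

theorem unmarkedExp_true (m : ℕ) (i : ℤ) (k : ℕ) (x : ℤ) :
    unmarkedExp m i k true x = nonresidueCount m i x (k + 1) := by
  simp [unmarkedExp, nonresidueCount]

theorem markedExp_true (m : ℕ) (i : ℤ) (k : ℕ) (x : ℤ) :
    markedExp m i k true x = residueCount m i x (k + 1) := by
  simp [markedExp, residueCount]

theorem unmarkedExp_false_add_self {m : ℕ} (hm : 0 < m) (i : ℤ) (k : ℕ) (x : ℤ) :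
    unmarkedExp m i (k + m) false x = nonresidueCount m i (x + 1) k + m := by
  rw [← nonresidueCount_add_self hm, unmarkedExp, add_comm]
  simp

theorem markedExp_false_add_self {m : ℕ} (hm : 0 < m) (i : ℤ) (k : ℕ) (x : ℤ) :
    markedExp m i (k + m) false x = residueCount m i (x + 1) k + 1 := by
  rw [markedExp, residueCount_add_self hm]
  simp

theorem fussCoeff_unmarkedExp_markedExp {m : ℕ} (hm : 0 < m) (i : ℤ) (n k : ℕ) (l : Bool)
    (x r : ℤ) :
    fussCoeff m (unmarkedExp m i k l x) (markedExp m i k l x) (n + 1) r =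
      fussCoeff m (nonresidueCount m i (x + 1) k) (residueCount m i (x + 1) k) (n + 1) r +
      fussCoeff m (unmarkedExp m i (k + m) false x) (markedExp m i (k + m) false x) n
        (r - if l ∧ x % m = i % m then 1 else 0) := by
  rw [unmarkedExp_false_add_self hm, markedExp_false_add_self hm, unmarkedExp, markedExp]
  split_ifs
  · rw [zero_add, add_comm 1, fussCoeff_succ_right hm]
  · rw [zero_add, add_comm 1, fussCoeff_succ_left hm, sub_zero]

theorem ncard_suffixSet {m : ℕ} (hm : 0 < m) (i : ℤ) (n k : ℕ) (l : Bool) (x r : ℤ) :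
    ((suffixSet m i n k l x r).ncard : ℚ) =
      fussCoeff m (unmarkedExp m i k l x) (markedExp m i k l x) n r := by
  induction n generalizing k l x r with
  | zero =>
    induction k generalizing l x with
    | zero =>
      rw [suffixSet_zero_zero]
      split_ifs with h <;> simp [fussCoeff, h]
    | succ k ih =>
      rw [suffixSet_zero_succ, Set.ncard_image_of_injective _ List.cons_injective, ih]
      rfl
  | succ n ihn =>
    induction k generalizing l x with
    | zero =>
      rw [suffixSet_succ_zero, Set.ncard_image_of_injective _ List.cons_injective, ihn,
        fussCoeff_unmarkedExp_markedExp hm, nonresidueCount, residueCount,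
        fussCoeff_zero_zero_succ, zero_add, zero_add]
    | succ k ih =>
      rw [ncard_suffixSet_succ_succ, Nat.cast_add, ih, ihn, unmarkedExp_true, markedExp_true,
        ← fussCoeff_unmarkedExp_markedExp hm]

theorem pt_zero (P : List Step) : pt P 0 = 0 := rfl

theorem pt_nil (k : ℕ) : pt [] k = 0 := by simp [pt]

theorem pt_cons_succ (s : Step) (P : List Step) (k : ℕ) :
    pt (s :: P) (k + 1) = stepVec s + pt P k := by simp [pt]

theorem pt_snd_nonneg (P : List Step) (k : ℕ) : 0 ≤ (pt P k).2 := by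
  induction P generalizing k with
  | nil => rw [pt_nil]; rfl
  | cons s P ih =>
    rcases k with _ | k
    · rw [pt_zero]; rfl
    · rw [pt_cons_succ]
      have := ih k
      rcases s <;> simp [stepVec] <;> lia

theorem isDyckSuffix_iff (m n k : ℕ) (P : List Step) :
    IsDyckSuffix m n k P ↔ (∀ s ∈ P, s ≠ Step.D) ∧ pt P P.length = ((m * n + k : ℤ), (n : ℤ)) ∧
      ∀ j, (pt P j).1 ≤ m * (pt P j).2 + k := by
  induction P generalizing n k with
  | nil =>
    simp only [pt_nil]
    rcases n with _ | n <;> rcases k with _ | k <;> simp [IsDyckSuffix, Prod.ext_iff] <;> lia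
  | cons s P ih =>
    have hall : ∀ q : ℕ → Prop, (∀ j, q j) ↔ q 0 ∧ ∀ j, q (j + 1) := fun q =>
      ⟨fun h => ⟨h 0, fun j => h _⟩, fun h j => by rcases j with _ | j; exacts [h.1, h.2 j]⟩
    rw [hall]
    simp only [pt_zero, pt_cons_succ, List.length_cons, Prod.ext_iff, Prod.fst_add, Prod.snd_add,
      List.forall_mem_cons]
    have hP := pt_snd_nonneg P P.length
    rcases s
    · rcases n with _ | n
      · simp [IsDyckSuffix, stepVec]
        lia
      · simp only [IsDyckSuffix, ih, stepVec, Prod.ext_iff]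
        refine ⟨fun ⟨h1, h2, h3⟩ => ⟨⟨by simp, h1⟩, ?_, ?_, fun j => ?_⟩,
          fun ⟨⟨_, h1⟩, h2, _, h3⟩ => ⟨h1, ?_, fun j => ?_⟩⟩
        · push_cast at h2 ⊢; constructor <;> linarith [h2.1, h2.2]
        · simp
        · have := h3 j; push_cast at this ⊢; linarith
        · push_cast at h2 ⊢; constructor <;> linarith [h2.1, h2.2]
        · have := h3 j; push_cast at this ⊢; linarith
    · rcases k with _ | k
      · have h0 : (pt P 0).1 = 0 ∧ (pt P 0).2 = 0 := ⟨rfl, rfl⟩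
        simp only [IsDyckSuffix, stepVec, false_iff]
        rintro ⟨_, _, _, h3⟩
        have := h3 0
        rw [h0.1, h0.2] at this
        simp at this
      · simp only [IsDyckSuffix, ih, stepVec, Prod.ext_iff]
        refine ⟨fun ⟨h1, h2, h3⟩ => ⟨⟨by simp, h1⟩, ?_, ?_, fun j => ?_⟩,
          fun ⟨⟨_, h1⟩, h2, _, h3⟩ => ⟨h1, ?_, fun j => ?_⟩⟩
        · push_cast at h2 ⊢; constructor <;> linarith [h2.1, h2.2]
        · simp; lia
        · have := h3 j; push_cast at this ⊢; linarith
        · push_cast at h2 ⊢; constructor <;> linarith [h2.1, h2.2]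
        · have := h3 j; push_cast at this ⊢; linarith
    · simp [IsDyckSuffix]

theorem valleyCount_eq (m : ℕ) (i : ℤ) (l : Bool) (x : ℤ) (P : List Step) :
    valleyCount m i l x P = (if l ∧ P[0]? = some Step.N ∧ x % m = i % m then 1 else 0) +
      ((valleys P).filter fun j => (x + (pt P (j + 1)).1) % m = i % m).card := by
  induction P generalizing l x with
  | nil => simp [valleyCount, valleys]
  | cons s P ih =>
    have hsplit : ((valleys (s :: P)).filter
          fun j => (x + (pt (s :: P) (j + 1)).1) % m = i % m).card =
        (if s = .E ∧ P[0]? = some Step.N ∧ (x + 1) % m = i % m then 1 else 0) +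
        ((valleys P).filter
          fun j => (x + (stepVec s).1 + (pt P (j + 1)).1) % m = i % m).card := by
      simp only [valleys, Finset.filter_filter, Finset.card_filter, List.length_cons]
      rw [Finset.sum_range_succ', add_comm]
      congr 1
      · rcases s <;> simp [pt_cons_succ, pt_zero, stepVec]
      · simp [pt_cons_succ, add_assoc]
    rw [hsplit]
    rcases s <;> simp [valleyCount, ih, stepVec] <;> rfl

theorem ival_eq_valleyCount (m : ℕ) (i : ℤ) (P : List Step) :
    ival m i P = valleyCount m i false 0 P := by
  simp [valleyCount_eq, ival]

theorem setOf_isDyck_ival_eq (m n : ℕ) (i r : ℤ) :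
    {P : List Step | IsDyck m (n + 1 : ℕ) 1 P ∧ (ival m i P : ℤ) = r} =
      List.cons .N '' suffixSet m i n m false 0 r := by
  ext P
  have h : IsDyck m (n + 1 : ℕ) 1 P ↔
      [Step.N] <+: P ∧ IsDyckSuffix m (n + 1) 0 P := by
    rw [isDyckSuffix_iff, IsDyck, IsSchroeder, StartsNorth, AboveLine]
    simp
    tauto
  rw [Set.mem_ofPred_eq, h, ival_eq_valleyCount]
  rcases P with _ | ⟨_ | _ | _, P⟩ <;> simp [suffixSet, IsDyckSuffix, valleyCount]

theorem C_natCast_s14 (A : ℕ) (s : ℤ) : (C A s : ℚ) = intChoose A s := by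
  unfold C intChoose
  split_ifs <;> simp_all

/-- the number of `(m,1)`-Dyck paths of height `n` with `r` `i`-valleys,
for any `1 ≤ i ≤ m`. -/
theorem statement14 (m n i r : ℤ) (hm : 0 < m) (hn : 0 < n) (hi1 : 1 ≤ i) (him : i ≤ m)
    (hr0 : 0 ≤ r) (hr : r ≤ n - 1) :
    n * (({P : List Step | IsDyck m n 1 P ∧ (ival m i P : ℤ) = r}.ncard : ℤ))
      = C n r * C (m * n) (n - r - 1) := by
  obtain ⟨m, rfl⟩ := Int.eq_ofNat_of_zero_le hm.le
  obtain ⟨n, rfl⟩ : ∃ k : ℕ, n = (k + 1 : ℕ) := ⟨(n - 1).toNat, by lia⟩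
  have hm' : 0 < m := by exact_mod_cast hm
  rw [setOf_isDyck_ival_eq, Set.ncard_image_of_injective _ List.cons_injective, ← Nat.cast_mul]
  have h := ncard_suffixSet hm' i n m false 0 r
  have hu := unmarkedExp_false_add_self hm' i 0 0
  have hk := markedExp_false_add_self hm' i 0 0
  rw [zero_add, nonresidueCount, zero_add] at hu
  rw [zero_add, residueCount, zero_add] at hk
  rw [hu, hk] at h
  have key := succ_mul_fussCoeff hm' n r
  rw [← h, ← C_natCast_s14, ← C_natCast_s14] at key
  rw [show ((n + 1 : ℕ) : ℤ) - r - 1 = n - r by push_cast; ring]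
  exact_mod_cast key
end
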